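/- arXiv:1203.6640 — 3 statements merged into one kernel-verified Lean document; each statement's English description precedes it below -/
import Mathlib

section
/- Let p be a prime and k a natural number with base-p expansion k = Σ_s k_s·p^s, 0 ≤ k_s ≤ p−1. Then the product Π_s (k_s·p^s)! divides k!, and the quotient k! / Π_s (k_s·p^s)! is congruent to 1 modulo p. -/
theorem choose_add_mul_pow_modEq_one {p : ℕ} (hp : p.Prime) (d n : ℕ) :
    ∀ m < p ^ n, (m + d * p ^ n).choose m ≡ 1 [MOD p] := by
  have : Fact p.Prime := ⟨hp⟩
  induction n with
  | zero =>
    intro m hm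
    obtain rfl : m = 0 := by simpa using hm
    simpa using Nat.ModEq.refl 1
  | succ n ih =>
    intro m hm
    have hmod : (m + d * p ^ (n + 1)) % p = m % p := by
      rw [pow_succ, ← mul_assoc, Nat.add_mul_mod_self_right]
    have hdiv : (m + d * p ^ (n + 1)) / p = m / p + d * p ^ n := by
      rw [pow_succ, ← mul_assoc, Nat.add_mul_div_right _ _ hp.pos]
    have hlt : m / p < p ^ n := by
      rwa [Nat.div_lt_iff_lt_mul hp.pos, ← pow_succ]
    have h := Choose.choose_modEq_choose_mod_mul_choose_div_nat
      (p := p) (n := m + d * p ^ (n + 1)) (k := m)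
    rw [hmod, hdiv, Nat.choose_self, one_mul] at h
    exact h.trans (ih _ hlt)

theorem exists_factorial_mod_pow_eq_mul_prod {p : ℕ} (hp : p.Prime) (k n : ℕ) :
    ∃ q, q ≡ 1 [MOD p] ∧ (k % p ^ n).factorial =
      q * ∏ s ∈ Finset.range n, ((k / p ^ s % p) * p ^ s).factorial := by
  induction n with
  | zero => exact ⟨1, Nat.ModEq.refl 1, by simp [Nat.mod_one]⟩
  | succ n ih =>
    obtain ⟨q, hq, h⟩ := ih
    refine ⟨(k % p ^ n + k / p ^ n % p * p ^ n).choose (k % p ^ n) * q,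
      (choose_add_mul_pow_modEq_one hp _ n _ (Nat.mod_lt _ (pow_pos hp.pos n))).mul hq, ?_⟩
    rw [Nat.mod_pow_succ, mul_comm (p ^ n), Finset.prod_range_succ,
      ← Nat.add_choose_mul_factorial_mul_factorial, h, Nat.choose_symm_add]
    ring

/-- Let `p` be a prime and `k` a natural number with base-`p` expansion
`k = Σ_s k_s·p^s` (so `k_s` is the `s`-th digit of `k` in base `p`).
Then the product `Π_s (k_s·p^s)!` divides `k!`, and the quotient
`k! / Π_s (k_s·p^s)!` is congruent to `1` modulo `p`. -/
theorem stmt_5 (p : ℕ) (hp : p.Prime) (k : ℕ) :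
    (∏ s ∈ Finset.range (Nat.digits p k).length,
        (((Nat.digits p k).getD s 0) * p ^ s).factorial) ∣ k.factorial ∧
    k.factorial / (∏ s ∈ Finset.range (Nat.digits p k).length,
        (((Nat.digits p k).getD s 0) * p ^ s).factorial) ≡ 1 [MOD p] := by
  simp only [Nat.getD_digits _ _ hp.two_le]
  obtain ⟨q, hq, h⟩ := exists_factorial_mod_pow_eq_mul_prod hp k (Nat.digits p k).length
  rw [Nat.mod_eq_of_lt (Nat.lt_base_pow_length_digits hp.one_lt)] at h
  rw [h, Nat.mul_div_cancel _ (Finset.prod_pos fun _ _ => Nat.factorial_pos _)]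
  exact ⟨dvd_mul_left _ _, hq⟩
end

section
/- For every prime p and every natural number k, the factorial ((p−1)·p^k)! is divisible by ((p^k)!)^{p−1}, and the quotient ((p−1)·p^k)! / ((p^k)!)^{p−1} is congruent to −1 modulo p. (Equivalently, in the Kostant ℤ-form, a_k^{p−1} + E₁₂^((p−1)p^k) ∈ pU_ℤ.) -/
theorem exists_factorial_mul_prime_pow_eq (p : ℕ) [Fact p.Prime] (k m : ℕ) :
    ∃ q, (m * p ^ k).factorial = (p ^ k).factorial ^ m * q ∧ q ≡ m.factorial [MOD p] := by
  induction m with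
  | zero => exact ⟨1, by simp, by simpa using Nat.ModEq.refl _⟩
  | succ m ih =>
    obtain ⟨q, hq, hmod⟩ := ih
    refine ⟨((m + 1) * p ^ k).choose (p ^ k) * q, ?_, ?_⟩
    · have h := Nat.add_choose_mul_factorial_mul_factorial (m * p ^ k) (p ^ k)
      rw [hq, ← Nat.succ_mul, Nat.succ_eq_add_one] at h
      rw [← h]
      ring
    · have h : ((m + 1) * p ^ k).choose (p ^ k) ≡ m + 1 [MOD p] := by
        simpa [mul_comm] using Choose.choose_pow_mul_pow_mul_modEq_choose_nat
          (p := p) (k := k) (a := m + 1) (b := 1)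
      rw [Nat.factorial_succ]
      exact h.mul hmod

/-- For every prime `p` and every natural number `k`, the factorial
`((p−1)·p^k)!` is divisible by `((p^k)!)^{p−1}`, and the quotient
`((p−1)·p^k)! / ((p^k)!)^{p−1}` is congruent to `−1` modulo `p`. -/
theorem stmt_6 (p : ℕ) (hp : p.Prime) (k : ℕ) :
    ((p ^ k).factorial) ^ (p - 1) ∣ ((p - 1) * p ^ k).factorial ∧
      ((((p - 1) * p ^ k).factorial / ((p ^ k).factorial) ^ (p - 1) : ℕ) : ℤ)
        ≡ -1 [ZMOD (p : ℤ)] := by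
  have : Fact p.Prime := ⟨hp⟩
  obtain ⟨q, hq, hmod⟩ := exists_factorial_mul_prime_pow_eq p k (p - 1)
  refine ⟨⟨q, hq⟩, ?_⟩
  rw [hq, Nat.mul_div_cancel_left _ (pow_pos (Nat.factorial_pos _) _),
    ← ZMod.intCast_eq_intCast_iff]
  push_cast
  rw [(ZMod.natCast_eq_natCast_iff _ _ _).mpr hmod, ZMod.wilsons_lemma]
end

section
/- Let p be a prime and k < l natural numbers. Then for every j with 1 ≤ j ≤ p^k, the binomial coefficient C(p^l − j, (p−1)·p^k) is congruent to 1 modulo p. -/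
/-- Let `p` be a prime and `k < l` natural numbers. Then for every `j` with
`1 ≤ j ≤ p^k`, the binomial coefficient `C(p^l − j, (p−1)·p^k)` is congruent
to `1` modulo `p`. -/
theorem stmt_9 (p : ℕ) (hp : p.Prime) (k l : ℕ) (hkl : k < l) (j : ℕ)
    (hj1 : 1 ≤ j) (hj2 : j ≤ p ^ k) :
    (p ^ l - j).choose ((p - 1) * p ^ k) ≡ 1 [MOD p] := by
  have : Fact p.Prime := ⟨hp⟩
  have hp0 : 0 < p := hp.pos
  induction k generalizing l j with
  | zero =>
    obtain ⟨l, rfl⟩ : ∃ m, l = m + 1 := ⟨l - 1, by omega⟩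
    obtain rfl : j = 1 := by rw [pow_zero] at hj2; omega
    have hn : p ^ (l + 1) - 1 = (p - 1) + p * (p ^ l - 1) := by
      have hle : p ≤ p * p ^ l := Nat.le_mul_of_pos_right p (by positivity)
      rw [pow_succ', Nat.mul_sub, mul_one]
      omega
    have hlt : p - 1 < p := by omega
    refine Choose.choose_modEq_choose_mod_mul_choose_div_nat.trans ?_
    rw [hn, pow_zero, mul_one, Nat.add_mul_mod_self_left, Nat.mod_eq_of_lt hlt,
      Nat.div_eq_of_lt hlt, Nat.choose_self, Nat.choose_zero_right]
  | succ k ih =>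
    obtain ⟨l, rfl⟩ : ∃ m, l = m + 1 := ⟨l - 1, by omega⟩
    obtain ⟨i, rfl⟩ := Nat.exists_eq_add_of_le' hj1
    have hi : i < p * p ^ l := calc
      i < p ^ (k + 1) := hj2
      _ ≤ p ^ (l + 1) := Nat.pow_le_pow_right hp0 hkl.le
      _ = p * p ^ l := pow_succ' p l
    have hm : (p - 1) * p ^ (k + 1) = p * ((p - 1) * p ^ k) := by ring
    refine Choose.choose_modEq_choose_mod_mul_choose_div_nat.trans ?_
    rw [hm, Nat.mul_mod_right, Nat.mul_div_cancel_left _ hp0, Nat.choose_zero_right,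
      one_mul, pow_succ', Nat.mul_sub_div i p (p ^ l) hi]
    refine ih l (by omega) _ (Nat.succ_pos _) ((Nat.div_lt_iff_lt_mul hp0).mpr ?_)
    rwa [← pow_succ]
end
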